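/- arXiv:2012.01029 — 7 statements merged into one kernel-verified Lean document; each statement's English description precedes it below -/
import Mathlib

section
/- Let V be a finite-dimensional real vector space, let 𝒢 be a finite family of vectors in V, and let h ∈ V be a nonnegative linear combination of 𝒢, i.e. h = Σ_{f∈𝒢} α_f f with α_f ≥ 0 for all f ∈ 𝒢. Then there exists a linearly independent subfamily 𝒢' ⊆ 𝒢 and coefficients β_f ≥ 0 such that h = Σ_{f∈𝒢'} β_f f. -/
/-- The reduction step of the conical Carathéodory theorem. -/
theorem exists_erase_nonneg_sum_smul_eq_of_not_linearIndepOn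
    {R M ι : Type*} [Field R] [LinearOrder R] [IsStrictOrderedRing R] [AddCommGroup M] [Module R M]
    [DecidableEq ι] {v : ι → M} {s : Finset ι} (hs : ¬ LinearIndepOn R v (s : Set ι))
    {a : ι → R} (ha : ∀ i ∈ s, 0 ≤ a i) :
    ∃ j ∈ s, ∃ b : ι → R, (∀ i ∈ s.erase j, 0 ≤ b i) ∧
      ∑ i ∈ s.erase j, b i • v i = ∑ i ∈ s, a i • v i := by
  obtain ⟨g, hg, k, hks, hk⟩ : ∃ g : ι → R, ∑ i ∈ s, g i • v i = 0 ∧ ∃ i ∈ s, 0 < g i := by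
    obtain ⟨g, hg, k, hks, hk⟩ := not_linearIndepOn_finset_iff.1 hs
    rcases hk.lt_or_gt with hk | hk
    · exact ⟨-g, by simp [hg], k, hks, by simpa using hk⟩
    · exact ⟨g, hg, k, hks, hk⟩
  obtain ⟨j, hj, hmin⟩ := (s.filter (0 < g ·)).exists_min_image (fun i => a i / g i)
    ⟨k, by simp [hks, hk]⟩
  obtain ⟨hjs, hgj⟩ := Finset.mem_filter.1 hj
  refine ⟨j, hjs, fun i => a i - a j / g j * g i, fun i hi => ?_, ?_⟩
  · have his := Finset.mem_of_mem_erase hi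
    rw [sub_nonneg]
    rcases lt_or_ge 0 (g i) with hgi | hgi
    · exact (le_div_iff₀ hgi).1 (hmin i (Finset.mem_filter.2 ⟨his, hgi⟩))
    · exact (mul_nonpos_of_nonneg_of_nonpos (div_nonneg (ha j hjs) hgj.le) hgi).trans (ha i his)
  · rw [Finset.sum_erase s (by simp [hgj.ne'])]
    simp only [sub_smul, mul_smul, Finset.sum_sub_distrib, ← Finset.smul_sum, hg, smul_zero,
      sub_zero]

/-- The conical Carathéodory theorem for finite indexed families. -/
theorem exists_linearIndepOn_nonneg_sum_smul_eq
    {R M ι : Type*} [Field R] [LinearOrder R] [IsStrictOrderedRing R] [AddCommGroup M] [Module R M]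
    (v : ι → M) (s : Finset ι) (a : ι → R) (ha : ∀ i ∈ s, 0 ≤ a i) :
    ∃ t ⊆ s, ∃ b : ι → R, LinearIndepOn R v (t : Set ι) ∧ (∀ i ∈ t, 0 ≤ b i) ∧
      ∑ i ∈ t, b i • v i = ∑ i ∈ s, a i • v i := by
  classical
  induction s using Finset.strongInduction generalizing a with
  | H s ih =>
    by_cases hs : LinearIndepOn R v (s : Set ι)
    · exact ⟨s, subset_rfl, a, hs, ha, rfl⟩
    obtain ⟨j, hj, c, hc, hsum⟩ := exists_erase_nonneg_sum_smul_eq_of_not_linearIndepOn hs ha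
    obtain ⟨t, hts, b, ht, hb, hbsum⟩ := ih _ (Finset.erase_ssubset hj) c hc
    exact ⟨t, hts.trans (s.erase_subset j), b, ht, hb, hbsum.trans hsum⟩


/-- If `h` is a nonnegative linear combination of a finite family `G` of
vectors in a finite-dimensional real vector space `V`, then `h` is a nonnegative linear
combination of a linearly independent subfamily of `G`. -/
theorem nonneg_combination_of_linearIndependent_subfamily
    {V : Type*} [AddCommGroup V] [Module ℝ V] [FiniteDimensional ℝ V]
    {ι : Type*} [Fintype ι] (G : ι → V) (α : ι → ℝ) (hα : ∀ i, 0 ≤ α i)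
    (h : V) (hh : h = ∑ i, α i • G i) :
    ∃ (s : Finset ι) (β : ι → ℝ),
      LinearIndependent ℝ (fun i : s => G i) ∧
      (∀ i ∈ s, 0 ≤ β i) ∧ h = ∑ i ∈ s, β i • G i := by
  obtain ⟨s, -, β, hs, hβ, hsum⟩ :=
    exists_linearIndepOn_nonneg_sum_smul_eq G Finset.univ α fun i _ => hα i
  exact ⟨s, β, hs, hβ, hh.trans hsum.symm⟩
end

section
/- Let V be a finite-dimensional real vector space, let 𝒢 be a finite family of vectors that spans V, and let h ∈ V be a nonnegative linear combination of 𝒢, i.e. h = Σ_{f∈𝒢} α_f f with α_f ≥ 0 for all f. Then there exists a subfamily B ⊆ 𝒢 that is a basis of V and coefficients β_f ≥ 0 such that h = Σ_{f∈B} β_f f. -/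
/-- **Carathéodory's theorem for cones**: a nonnegative linear combination of a finite family is
a nonnegative linear combination of a linearly independent subfamily. -/
theorem exists_linearIndepOn_nonneg_combination {K V ι : Type*} [Field K] [LinearOrder K]
    [IsStrictOrderedRing K] [AddCommGroup V] [Module K V] (v : ι → V) (s : Finset ι)
    (a : ι → K) (ha : ∀ i ∈ s, 0 ≤ a i) :
    ∃ t ⊆ s, ∃ b : ι → K, LinearIndepOn K v (t : Set ι) ∧ (∀ i ∈ t, 0 ≤ b i) ∧
      ∑ i ∈ t, b i • v i = ∑ i ∈ s, a i • v i := by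
  classical
  induction s using Finset.strongInduction generalizing a with
  | H s ih =>
    by_cases hs : LinearIndepOn K v (s : Set ι)
    · exact ⟨s, subset_rfl, a, hs, ha, rfl⟩
    obtain ⟨g, hg, k, hk, hgk⟩ :
        ∃ g : ι → K, ∑ i ∈ s, g i • v i = 0 ∧ ∃ k ∈ s, 0 < g k := by
      rw [linearIndepOn_finset_iff] at hs
      push Not at hs
      obtain ⟨f, hf, k, hk, hfk⟩ := hs
      rcases hfk.lt_or_gt with hneg | hpos
      · exact ⟨-f, by simp [hf], k, hk, by simpa using hneg⟩
      · exact ⟨f, hf, k, hk, hpos⟩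
    obtain ⟨j, hj, hmin⟩ := Finset.exists_min_image (s.filter fun i => 0 < g i)
      (fun i => a i / g i) ⟨k, Finset.mem_filter.2 ⟨hk, hgk⟩⟩
    obtain ⟨hjs, hgj⟩ := Finset.mem_filter.1 hj
    have hratio : 0 ≤ a j / g j := div_nonneg (ha j hjs) hgj.le
    have hnonneg : ∀ i ∈ s, 0 ≤ a i - a j / g j * g i := by
      intro i hi
      rcases le_or_gt (g i) 0 with hgi | hgi
      · linarith [ha i hi, mul_nonpos_of_nonneg_of_nonpos hratio hgi]
      · exact sub_nonneg.2 <| (le_div_iff₀ hgi).1 <| hmin i (Finset.mem_filter.2 ⟨hi, hgi⟩)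
    obtain ⟨t, hts, b, hind, hb, hsum⟩ := ih (s.erase j) (Finset.erase_ssubset hjs)
      (fun i => a i - a j / g j * g i) fun i hi => hnonneg i (Finset.mem_of_mem_erase hi)
    refine ⟨t, hts.trans (s.erase_subset j), b, hind, hb, hsum.trans ?_⟩
    rw [Finset.sum_erase s (by simp [div_mul_cancel₀ (a j) hgj.ne'])]
    simp [sub_smul, mul_smul, ← Finset.smul_sum, hg]

/-- If `h` is a nonnegative linear combination of a finite spanning family `G`
of vectors in a finite-dimensional real vector space `V`, then there is a subfamily of `G`
which is a basis of `V` (i.e. linearly independent and spanning) and such that `h` is a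
nonnegative linear combination of that subfamily. -/
theorem nonneg_combination_of_basis_subfamily
    {V : Type*} [AddCommGroup V] [Module ℝ V] [FiniteDimensional ℝ V]
    {ι : Type*} [Fintype ι] (G : ι → V)
    (hspan : Submodule.span ℝ (Set.range G) = ⊤)
    (α : ι → ℝ) (hα : ∀ i, 0 ≤ α i)
    (h : V) (hh : h = ∑ i, α i • G i) :
    ∃ (s : Finset ι) (β : ι → ℝ),
      LinearIndependent ℝ (fun i : s => G i) ∧
      Submodule.span ℝ (G '' (s : Set ι)) = ⊤ ∧
      (∀ i ∈ s, 0 ≤ β i) ∧ h = ∑ i ∈ s, β i • G i := by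
  classical
  obtain ⟨t, -, b, hind, hb, hsum⟩ :=
    exists_linearIndepOn_nonneg_combination G Finset.univ α fun i _ => hα i
  obtain ⟨u, -, htu, hspan_u, hu⟩ := exists_linearIndepOn_extension hind (Set.subset_univ _)
  lift u to Finset ι using u.toFinite
  rw [Finset.coe_subset] at htu
  refine ⟨u, fun i => if i ∈ t then b i else 0, hu, ?_, fun i _ => ?_, ?_⟩
  · rw [eq_top_iff, ← hspan, Submodule.span_le, ← Set.image_univ]
    exact hspan_u
  · dsimp only
    split_ifs with hi
    exacts [hb i hi, le_rfl]
  · simp only [ite_smul, zero_smul]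
    rw [← Finset.sum_filter, Finset.filter_mem_eq_inter, Finset.inter_eq_right.2 htu, hsum, hh]
end

section
/- Let (a_s)_{s≥0} be a sequence of real numbers, T > 0, and for r ∈ ℕ let p_r(t) = Σ_{s=0}^r a_s t^s denote the partial sums of the power series Σ_{s≥0} a_s t^s. Then for every t ∈ [0, T] and every r ∈ ℕ there exist nonnegative coefficients λ_0, …, λ_r with Σ_{s=0}^r λ_s = 1 such that p_r(t) = Σ_{s=0}^r λ_s p_s(T); that is, p_r(t) is a convex combination of p_0(T), …, p_r(T). -/
/-- The `r`-th partial sum polynomial of the power series `∑ aₛ tˢ`. -/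
noncomputable def partialSum (a : ℕ → ℝ) (t : ℝ) (r : ℕ) : ℝ :=
  ∑ s ∈ Finset.range (r + 1), a s * t ^ s

/-- Summation by parts for the partial sums of a power series, rescaled by a factor `x`. -/
theorem partialSum_mul_eq (a : ℕ → ℝ) (x T : ℝ) (r : ℕ) :
    partialSum a (x * T) r =
      ∑ s ∈ Finset.range r, (x ^ s - x ^ (s + 1)) * partialSum a T s +
        x ^ r * partialSum a T r := by
  induction r with
  | zero => simp [partialSum]
  | succ r ih =>
    have h (t : ℝ) : partialSum a t (r + 1) = partialSum a t r + a (r + 1) * t ^ (r + 1) :=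
      Finset.sum_range_succ _ _
    rw [h, ih, Finset.sum_range_succ, h]
    ring

/-- For `t ∈ [0, T]` the partial sum `p_r(t)` is a convex combination of the
partial sums `p_0(T), …, p_r(T)`. -/
theorem partialSum_convex_combination (a : ℕ → ℝ) (T : ℝ) (hT : 0 < T) :
    ∀ t ∈ Set.Icc (0 : ℝ) T, ∀ r : ℕ,
      ∃ lam : ℕ → ℝ, (∀ s ≤ r, 0 ≤ lam s) ∧
        (∑ s ∈ Finset.range (r + 1), lam s) = 1 ∧
        partialSum a t r = ∑ s ∈ Finset.range (r + 1), lam s * partialSum a T s := by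
  rintro t ⟨ht0, htT⟩ r
  have hx0 : 0 ≤ t / T := div_nonneg ht0 hT.le
  have hx1 : t / T ≤ 1 := (div_le_one hT).2 htT
  have hxT : t / T * T = t := div_mul_cancel₀ t hT.ne'
  generalize t / T = x at hx0 hx1 hxT
  have hlt (s : ℕ) (hs : s ∈ Finset.range r) :
      (if s < r then x ^ s - x ^ (s + 1) else x ^ s) = x ^ s - x ^ (s + 1) :=
    if_pos (Finset.mem_range.1 hs)
  refine ⟨fun s => if s < r then x ^ s - x ^ (s + 1) else x ^ s, fun s _ => ?_, ?_, ?_⟩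
  · dsimp only
    split_ifs
    · exact sub_nonneg.2 (pow_le_pow_of_le_one hx0 hx1 s.le_succ)
    · exact pow_nonneg hx0 s
  · rw [Finset.sum_range_succ, Finset.sum_congr rfl hlt, Finset.sum_range_sub']
    simp
  · beta_reduce
    rw [← hxT, partialSum_mul_eq, Finset.sum_range_succ, if_neg (lt_irrefl r)]
    congr 1
    exact Finset.sum_congr rfl fun s hs => by rw [hlt s hs]
end

section
/- Let Q be an arbitrary real m×m matrix, h ∈ ℝ^m, (a_s)_{s≥0} a sequence of real numbers, T > 0, and for r ∈ ℕ let p_r(tQ) = Σ_{s=0}^r a_s t^s Q^s. Then for every t ∈ [0, T] and every r ∈ ℕ there exist nonnegative coefficients λ_0, …, λ_r with Σ_{s=0}^r λ_s = 1 such that p_r(tQ)h = Σ_{s=0}^r λ_s p_s(TQ)h. -/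
/-- The `r`-th matrix partial sum `p_r(tQ) = ∑_{s=0}^r aₛ tˢ Qˢ`. -/
noncomputable def matPartialSum {m : ℕ} (a : ℕ → ℝ) (Q : Matrix (Fin m) (Fin m) ℝ) (t : ℝ)
    (r : ℕ) : Matrix (Fin m) (Fin m) ℝ :=
  ∑ s ∈ Finset.range (r + 1), (a s * t ^ s) • Q ^ s

/-- Summation by parts. -/
theorem sum_range_succ_smul_eq_sum_sub_smul {R M : Type*} [Ring R] [AddCommGroup M] [Module R M]
    (c : ℕ → R) (v : ℕ → M) (r : ℕ) :
    ∑ s ∈ Finset.range (r + 1), c s • v s =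
      ∑ s ∈ Finset.range r, (c s - c (s + 1)) • ∑ i ∈ Finset.range (s + 1), v i +
        c r • ∑ i ∈ Finset.range (r + 1), v i := by
  induction r with
  | zero => simp
  | succ r ih =>
    rw [Finset.sum_range_succ, ih, Finset.sum_range_succ (fun s => (c s - c (s + 1)) • _) r, Finset.sum_range_succ v (r + 1),
      sub_smul, smul_add]
    abel

theorem matPartialSum_mulVec {m : ℕ} (a : ℕ → ℝ) (Q : Matrix (Fin m) (Fin m) ℝ) (t : ℝ) (r : ℕ)
    (h : Fin m → ℝ) :
    (matPartialSum a Q t r).mulVec h =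
      ∑ s ∈ Finset.range (r + 1), (a s * t ^ s) • (Q ^ s).mulVec h := by
  simp only [matPartialSum, Matrix.sum_mulVec, Matrix.smul_mulVec]

/-- For `t ∈ [0, T]` the vector `p_r(tQ)h` is a convex combination of the
vectors `p_0(TQ)h, …, p_r(TQ)h`. -/
theorem matPartialSum_convex_combination {m : ℕ} (Q : Matrix (Fin m) (Fin m) ℝ)
    (h : Fin m → ℝ) (a : ℕ → ℝ) (T : ℝ) (hT : 0 < T) :
    ∀ t ∈ Set.Icc (0 : ℝ) T, ∀ r : ℕ,
      ∃ lam : ℕ → ℝ, (∀ s ≤ r, 0 ≤ lam s) ∧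
        (∑ s ∈ Finset.range (r + 1), lam s) = 1 ∧
        (matPartialSum a Q t r).mulVec h =
          ∑ s ∈ Finset.range (r + 1), lam s • (matPartialSum a Q T s).mulVec h := by
  rintro t ⟨ht0, htT⟩ r
  have hx0 : 0 ≤ t / T := by positivity
  have hx1 : t / T ≤ 1 := (div_le_one hT).2 htT
  have htx : t = t / T * T := (div_mul_cancel₀ t hT.ne').symm
  generalize t / T = x at hx0 hx1 htx
  have hlam : ∀ s ∈ Finset.range r,
      (if s < r then x ^ s - x ^ (s + 1) else x ^ s) = x ^ s - x ^ (s + 1) :=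
    fun s hs => if_pos (Finset.mem_range.1 hs)
  refine ⟨fun s => if s < r then x ^ s - x ^ (s + 1) else x ^ s, fun s _ => ?_, ?_, ?_⟩
  · dsimp only
    split_ifs
    · exact sub_nonneg.2 (pow_le_pow_of_le_one hx0 hx1 s.le_succ)
    · exact pow_nonneg hx0 s
  · rw [Finset.sum_range_succ, Finset.sum_congr rfl hlam, Finset.sum_range_sub']
    simp
  · rw [Finset.sum_range_succ,
      Finset.sum_congr rfl fun s hs => congrArg (· • (matPartialSum a Q T s).mulVec h) (hlam s hs)]
    simp only [matPartialSum_mulVec, lt_irrefl, if_false]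
    rw [← sum_range_succ_smul_eq_sum_sub_smul (fun s => x ^ s)]
    refine Finset.sum_congr rfl fun s _ => ?_
    rw [smul_smul, htx, mul_pow, mul_left_comm]
end

section
/- Let Q be a real m×m matrix, h ∈ ℝ^m, C ⊆ ℝ^m a convex set with h ∈ C, ε > 0, T > 0, and r ∈ ℕ. Suppose that for every s ∈ {0, …, r} one can write p_s(TQ)h = c_s + e_s with c_s ∈ C and ‖e_s‖_c ≤ ε. Then for every t ∈ [0, T] and every s ∈ {0, …, r} one can write p_s(tQ)h = c + e with c ∈ C and ‖e‖_c ≤ ε. -/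
/-- Half the variational seminorm: `‖f‖_c = (max f − min f)/2`. -/
noncomputable def cNorm {m : ℕ} (f : Fin m → ℝ) : ℝ := ((⨆ i, f i) - ⨅ i, f i) / 2

/-- The `r`-th partial sum of the Taylor series of the matrix exponential `e^{tQ}`. -/
noncomputable def expPartial {m : ℕ} (Q : Matrix (Fin m) (Fin m) ℝ) (t : ℝ) (r : ℕ) :
    Matrix (Fin m) (Fin m) ℝ :=
  ∑ s ∈ Finset.range (r + 1), (t ^ s / (s.factorial : ℝ)) • Q ^ s

theorem cNorm_smul_add_smul_le {m : ℕ} (f g : Fin m → ℝ) {a b : ℝ} (ha : 0 ≤ a) (hb : 0 ≤ b) :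
    cNorm (a • f + b • g) ≤ a * cNorm f + b * cNorm g := by
  unfold cNorm
  rcases isEmpty_or_nonempty (Fin m) with hm | hm
  · simp
  have hsup : (⨆ i, (a • f + b • g) i) ≤ a * (⨆ i, f i) + b * ⨆ i, g i :=
    ciSup_le fun i => add_le_add
      (mul_le_mul_of_nonneg_left (le_ciSup (Set.finite_range f).bddAbove i) ha)
      (mul_le_mul_of_nonneg_left (le_ciSup (Set.finite_range g).bddAbove i) hb)
  have hinf : a * (⨅ i, f i) + b * (⨅ i, g i) ≤ ⨅ i, (a • f + b • g) i :=
    le_ciInf fun i => add_le_add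
      (mul_le_mul_of_nonneg_left (ciInf_le (Set.finite_range f).bddBelow i) ha)
      (mul_le_mul_of_nonneg_left (ciInf_le (Set.finite_range g).bddBelow i) hb)
  linarith

theorem convex_setOf_cNorm_le {m : ℕ} (ε : ℝ) : Convex ℝ {e : Fin m → ℝ | cNorm e ≤ ε} := by
  intro f hf g hg a b ha hb hab
  calc cNorm (a • f + b • g) ≤ a * cNorm f + b * cNorm g := cNorm_smul_add_smul_le f g ha hb
    _ ≤ a * ε + b * ε :=
      add_le_add (mul_le_mul_of_nonneg_left hf ha) (mul_le_mul_of_nonneg_left hg hb)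
    _ = ε := by rw [← add_mul, hab, one_mul]

/-- Damping the increments of a sequence in a convex set by powers of `l ∈ [0, 1]` keeps it in
the set. -/
theorem Convex.add_sum_pow_smul_sub_mem {E : Type*} [AddCommGroup E] [Module ℝ E] {S : Set E}
    (hS : Convex ℝ S) {l : ℝ} (hl₀ : 0 ≤ l) (hl₁ : l ≤ 1) (n : ℕ) (x : ℕ → E)
    (hx : ∀ k ≤ n, x k ∈ S) :
    x 0 + ∑ k ∈ Finset.range n, l ^ (k + 1) • (x (k + 1) - x k) ∈ S := by
  induction n generalizing x with
  | zero => simpa using hx 0 le_rfl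
  | succ n ih =>
    have key := hS (hx 0 (Nat.zero_le _)) (ih (fun k => x (k + 1)) fun k hk => hx _ (by omega))
      (sub_nonneg.2 hl₁) hl₀ (by ring)
    convert key using 1
    rw [Finset.sum_range_succ', smul_add, Finset.smul_sum]
    simp only [smul_smul, ← pow_succ']
    module

theorem expPartial_zero {m : ℕ} (Q : Matrix (Fin m) (Fin m) ℝ) (t : ℝ) : expPartial Q t 0 = 1 := by
  simp [expPartial]

theorem expPartial_succ {m : ℕ} (Q : Matrix (Fin m) (Fin m) ℝ) (t : ℝ) (n : ℕ) :
    expPartial Q t (n + 1) =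
      expPartial Q t n + (t ^ (n + 1) / ((n + 1).factorial : ℝ)) • Q ^ (n + 1) :=
  Finset.sum_range_succ _ _

theorem expPartial_mul_left {m : ℕ} (Q : Matrix (Fin m) (Fin m) ℝ) (l t : ℝ) (n : ℕ) :
    expPartial Q (l * t) n = expPartial Q t 0 +
      ∑ k ∈ Finset.range n, l ^ (k + 1) • (expPartial Q t (k + 1) - expPartial Q t k) := by
  induction n with
  | zero => simp [expPartial_zero]
  | succ n ih =>
    rw [expPartial_succ, ih, Finset.sum_range_succ, expPartial_succ Q t n, add_sub_cancel_left,
      smul_smul, mul_pow, mul_div_assoc, add_assoc]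

/-- If for every `s ∈ {0, …, r}` the vector `p_s(TQ)h` decomposes as
`c_s + e_s` with `c_s ∈ C` (`C` convex, `h ∈ C`) and `‖e_s‖_c ≤ ε`, then the same kind of
decomposition exists for `p_s(tQ)h` for every `t ∈ [0, T]` and `s ∈ {0, …, r}`. -/
theorem expPartial_approx_decomposition {m : ℕ} (Q : Matrix (Fin m) (Fin m) ℝ)
    (h : Fin m → ℝ) (C : Set (Fin m → ℝ)) (hC : Convex ℝ C) (hhC : h ∈ C)
    (ε T : ℝ) (hε : 0 < ε) (hT : 0 < T) (r : ℕ)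
    (hdec : ∀ s ≤ r, ∃ c e : Fin m → ℝ,
      c ∈ C ∧ cNorm e ≤ ε ∧ (expPartial Q T s).mulVec h = c + e) :
    ∀ t ∈ Set.Icc (0 : ℝ) T, ∀ s ≤ r, ∃ c e : Fin m → ℝ,
      c ∈ C ∧ cNorm e ≤ ε ∧ (expPartial Q t s).mulVec h = c + e := by
  intro t ht s hs
  let S : Set (Fin m → ℝ) :=
    (fun p : (Fin m → ℝ) × (Fin m → ℝ) => p.1 + p.2) '' (C ×ˢ {e | cNorm e ≤ ε})
  have hS : Convex ℝ S := (hC.prod (convex_setOf_cNorm_le ε)).is_linear_image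
    IsLinearMap.isLinearMap_add
  have hmem : (expPartial Q (t / T * T) s).mulVec h ∈ S := by
    rw [expPartial_mul_left, Matrix.add_mulVec, Matrix.sum_mulVec]
    simp only [Matrix.smul_mulVec, Matrix.sub_mulVec]
    refine hS.add_sum_pow_smul_sub_mem (div_nonneg ht.1 hT.le) ((div_le_one hT).2 ht.2) s
      (fun k => (expPartial Q T k).mulVec h) fun k hk => ?_
    obtain ⟨c, e, hc, he, hce⟩ := hdec k (hk.trans hs)
    exact ⟨(c, e), ⟨hc, he⟩, hce.symm⟩
  rw [div_mul_cancel₀ t hT.ne'] at hmem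
  obtain ⟨⟨c, e⟩, ⟨hc, he⟩, hce⟩ := hmem
  exact ⟨c, e, hc, he, hce.symm⟩
end

section
/- Let Q be a Q-matrix and f ∈ ℝ^m. Then ‖Qf‖ ≤ ‖Q‖ · ‖f‖_c, where ‖f‖_c is half the variational seminorm of f. -/
/-- The sup norm `‖f‖ = max_i |f_i|` on `ℝᵐ`. -/
noncomputable def supNorm {m : ℕ} (f : Fin m → ℝ) : ℝ := ⨆ i, |f i|

/-- The matrix norm induced by the sup norm: `‖Q‖ = max_k ∑_l |Q k l|`. -/
noncomputable def matNorm {m : ℕ} (Q : Matrix (Fin m) (Fin m) ℝ) : ℝ := ⨆ k, ∑ l, |Q k l|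

/-- A `Q`-matrix: nonnegative off-diagonal entries and zero row sums. -/
def IsQMatrix {m : ℕ} (Q : Matrix (Fin m) (Fin m) ℝ) : Prop :=
  (∀ k l, k ≠ l → 0 ≤ Q k l) ∧ ∀ k, ∑ l, Q k l = 0

/-- An imprecise `Q`-matrix: a nonempty compact convex set of `Q`-matrices. -/
def IsImpreciseQMatrix {m : ℕ} (𝒬 : Set (Matrix (Fin m) (Fin m) ℝ)) : Prop :=
  𝒬.Nonempty ∧ IsCompact 𝒬 ∧ Convex ℝ 𝒬 ∧ ∀ Q ∈ 𝒬, IsQMatrix Q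

/-- The lower transition rate operator `[Q̲ f]_k = min_{Q ∈ 𝒬} [Q f]_k`. -/
noncomputable def lowerQ {m : ℕ} (𝒬 : Set (Matrix (Fin m) (Fin m) ℝ)) (f : Fin m → ℝ) :
    Fin m → ℝ := fun k => sInf ((fun Q : Matrix (Fin m) (Fin m) ℝ => Q.mulVec f k) '' 𝒬)

/-- The norm of a set of matrices: `‖𝒬‖ = max_{Q ∈ 𝒬} ‖Q‖`. -/
noncomputable def setNorm {m : ℕ} (𝒬 : Set (Matrix (Fin m) (Fin m) ℝ)) : ℝ :=
  sSup (matNorm '' 𝒬)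

/-- The imprecision of `𝒬`: `ι(𝒬) = max_{Q, R ∈ 𝒬} ‖Q − R‖`. -/
noncomputable def iota {m : ℕ} (𝒬 : Set (Matrix (Fin m) (Fin m) ℝ)) : ℝ :=
  sSup ((fun p : Matrix (Fin m) (Fin m) ℝ × Matrix (Fin m) (Fin m) ℝ =>
    matNorm (p.1 - p.2)) '' (𝒬 ×ˢ 𝒬))

/-- Every entry of `f` lies within `cNorm f` of the midrange of `f`. -/
theorem abs_sub_midrange_le_cNorm {m : ℕ} (f : Fin m → ℝ) (l : Fin m) :
    |f l - ((⨆ i, f i) + ⨅ i, f i) / 2| ≤ cNorm f := by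
  have h₁ : f l ≤ ⨆ i, f i := le_ciSup (Set.finite_range f).bddAbove l
  have h₂ : ⨅ i, f i ≤ f l := ciInf_le (Set.finite_range f).bddBelow l
  rw [cNorm, abs_le]
  constructor <;> linarith

/-- For a `Q`-matrix `Q` and any `f ∈ ℝᵐ`, `‖Qf‖ ≤ ‖Q‖ · ‖f‖_c`. -/
theorem qMatrix_mulVec_le_cNorm {m : ℕ} (Q : Matrix (Fin m) (Fin m) ℝ)
    (hQ : IsQMatrix Q) (f : Fin m → ℝ) :
    supNorm (Q.mulVec f) ≤ matNorm Q * cNorm f := by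
  rcases isEmpty_or_nonempty (Fin m) with _ | _
  · simp [supNorm, matNorm]
  refine ciSup_le fun k => ?_
  set c := ((⨆ i, f i) + ⨅ i, f i) / 2
  have hc : 0 ≤ cNorm f := (abs_nonneg _).trans (abs_sub_midrange_le_cNorm f k)
  calc |Q.mulVec f k| = |∑ l, Q k l * (f l - c)| := by
        simp only [mul_sub, Finset.sum_sub_distrib, ← Finset.sum_mul, hQ.2 k, zero_mul, sub_zero]
        rfl
    _ ≤ ∑ l, |Q k l * (f l - c)| := Finset.abs_sum_le_sum_abs _ _
    _ ≤ ∑ l, |Q k l| * cNorm f := by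
        refine Finset.sum_le_sum fun l _ => ?_
        rw [abs_mul]
        exact mul_le_mul_of_nonneg_left (abs_sub_midrange_le_cNorm f l) (abs_nonneg _)
    _ = (∑ l, |Q k l|) * cNorm f := (Finset.sum_mul ..).symm
    _ ≤ matNorm Q * cNorm f :=
        mul_le_mul_of_nonneg_right
          (le_ciSup (f := fun k => ∑ l, |Q k l|) (Set.finite_range _).bddAbove k) hc
end

section
/- Let 𝒬 be an imprecise Q-matrix with lower transition rate operator Q̲. Then for every f ∈ ℝ^m one has ‖Q̲ f‖ ≤ ‖𝒬‖ · ‖f‖_c. -/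
theorem cNorm_nonneg {m : ℕ} (f : Fin m → ℝ) : 0 ≤ cNorm f := by
  rcases isEmpty_or_nonempty (Fin m) with _ | ⟨⟨i⟩⟩
  · simp [cNorm]
  · have h₁ := le_ciSup (Set.finite_range f).bddAbove i
    have h₂ := ciInf_le (Set.finite_range f).bddBelow i
    unfold cNorm
    linarith

theorem sum_abs_row_le_matNorm {m : ℕ} (Q : Matrix (Fin m) (Fin m) ℝ) (k : Fin m) :
    ∑ l, |Q k l| ≤ matNorm Q :=
  le_ciSup (f := fun k => ∑ l, |Q k l|) (Set.finite_range _).bddAbove k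

theorem matNorm_le_sum {m : ℕ} (Q : Matrix (Fin m) (Fin m) ℝ) :
    matNorm Q ≤ ∑ k, ∑ l, |Q k l| := by
  have hrow (k : Fin m) : 0 ≤ ∑ l, |Q k l| := Finset.sum_nonneg fun l _ => abs_nonneg _
  exact Real.iSup_le
    (fun k => Finset.single_le_sum (f := fun k => ∑ l, |Q k l|) (fun k _ => hrow k)
      (Finset.mem_univ k))
    (Finset.sum_nonneg fun k _ => hrow k)

theorem bddAbove_matNorm_image {m : ℕ} {𝒬 : Set (Matrix (Fin m) (Fin m) ℝ)}
    (h𝒬 : IsCompact 𝒬) : BddAbove (matNorm '' 𝒬) := by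
  have hcont : Continuous fun Q : Matrix (Fin m) (Fin m) ℝ => ∑ k, ∑ l, |Q k l| :=
    continuous_finsetSum _ fun k _ => continuous_finsetSum _ fun l _ =>
      (continuous_id.matrix_elem k l).abs
  obtain ⟨B, hB⟩ := h𝒬.bddAbove_image hcont.continuousOn
  refine ⟨B, ?_⟩
  rintro _ ⟨Q, hQ, rfl⟩
  exact (matNorm_le_sum Q).trans (hB ⟨Q, hQ, rfl⟩)

/-- The componentwise bound for a single matrix only needs its rows to sum to zero. -/
theorem abs_mulVec_le_matNorm_mul_cNorm {m : ℕ} {Q : Matrix (Fin m) (Fin m) ℝ}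
    (hQ : ∀ k, ∑ l, Q k l = 0) (f : Fin m → ℝ) (k : Fin m) :
    |Q.mulVec f k| ≤ matNorm Q * cNorm f := by
  set c := ((⨆ i, f i) + ⨅ i, f i) / 2
  have hshift : Q.mulVec f k = ∑ l, Q k l * (f l - c) := by
    simp only [mul_sub, Finset.sum_sub_distrib, ← Finset.sum_mul, hQ k, zero_mul, sub_zero]
    rfl
  calc |Q.mulVec f k| ≤ ∑ l, |Q k l * (f l - c)| := by
        rw [hshift]
        exact Finset.abs_sum_le_sum_abs _ _
    _ ≤ ∑ l, |Q k l| * cNorm f := by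
        refine Finset.sum_le_sum fun l _ => ?_
        rw [abs_mul]
        exact mul_le_mul_of_nonneg_left (abs_sub_midrange_le_cNorm f l) (abs_nonneg _)
    _ = (∑ l, |Q k l|) * cNorm f := (Finset.sum_mul _ _ _).symm
    _ ≤ matNorm Q * cNorm f :=
        mul_le_mul_of_nonneg_right (sum_abs_row_le_matNorm Q k) (cNorm_nonneg f)

theorem setNorm_nonneg {m : ℕ} (𝒬 : Set (Matrix (Fin m) (Fin m) ℝ)) : 0 ≤ setNorm 𝒬 := by
  refine Real.sSup_nonneg ?_
  rintro _ ⟨Q, -, rfl⟩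
  exact Real.iSup_nonneg fun k => Finset.sum_nonneg fun l _ => abs_nonneg _

/-- For an imprecise `Q`-matrix `𝒬` with lower transition rate operator `Q̲`,
`‖Q̲ f‖ ≤ ‖𝒬‖ · ‖f‖_c` for every `f ∈ ℝᵐ`. -/
theorem lowerQ_le_cNorm {m : ℕ} (𝒬 : Set (Matrix (Fin m) (Fin m) ℝ))
    (h𝒬 : IsImpreciseQMatrix 𝒬) (f : Fin m → ℝ) :
    supNorm (lowerQ 𝒬 f) ≤ setNorm 𝒬 * cNorm f := by
  obtain ⟨hne, hcompact, -, hQ⟩ := h𝒬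
  refine Real.iSup_le (fun k => ?_) (mul_nonneg (setNorm_nonneg 𝒬) (cNorm_nonneg f))
  have hbound : ∀ Q ∈ 𝒬, |Q.mulVec f k| ≤ setNorm 𝒬 * cNorm f := fun Q hmem =>
    (abs_mulVec_le_matNorm_mul_cNorm (hQ Q hmem).2 f k).trans <|
      mul_le_mul_of_nonneg_right
        (le_csSup (bddAbove_matNorm_image hcompact) ⟨Q, hmem, rfl⟩) (cNorm_nonneg f)
  have hlower : -(setNorm 𝒬 * cNorm f) ∈
      lowerBounds ((fun Q : Matrix (Fin m) (Fin m) ℝ => Q.mulVec f k) '' 𝒬) := by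
    rintro _ ⟨Q, hmem, rfl⟩
    exact (abs_le.mp (hbound Q hmem)).1
  obtain ⟨Q, hmem⟩ := hne
  exact abs_le.mpr ⟨le_csInf ⟨_, Q, hmem, rfl⟩ hlower,
    (csInf_le ⟨_, hlower⟩ ⟨Q, hmem, rfl⟩).trans (abs_le.mp (hbound Q hmem)).2⟩
end
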